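/- For all integers n ≥ 1 and 1 ≤ k ≤ ⌊(n−1)/2⌋, the polynomial (β+1) divides d_{n,k}(β) in ℤ[β], where d_{n,k}(β) = Σ_{σ∈S_n(k)} β^{cyc* σ − fix* σ} and S_n(k) is the set of permutations σ of [n] with cvalley* σ = k and cdd* σ = 0. -/

import Mathlib

open scoped Classical
open Finset

noncomputable section

namespace SZpaper

/-- `σ` as a 1-indexed function on `[1,n]`, extended by `0` elsewhere
(boundary convention `σ(0)=σ(n+1)=0`). -/
def pext (n : ℕ) (σ : Equiv.Perm (Fin n)) (i : ℕ) : ℕ :=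
  if h : 1 ≤ i ∧ i ≤ n then ((σ ⟨i - 1, by omega⟩ : Fin n) : ℕ) + 1 else 0

/-- `σ` extended with the Brändén boundary convention `σ(0)=σ(n+1)=n+1`. -/
def pextB (n : ℕ) (σ : Equiv.Perm (Fin n)) (i : ℕ) : ℕ :=
  if h : 1 ≤ i ∧ i ≤ n then ((σ ⟨i - 1, by omega⟩ : Fin n) : ℕ) + 1 else n + 1

/-- `σ` extended with the boundary convention `σ(0)=0`, `σ(n+1)=n+1`. -/
def pextC (n : ℕ) (σ : Equiv.Perm (Fin n)) (i : ℕ) : ℕ :=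
  if h : 1 ≤ i ∧ i ≤ n then ((σ ⟨i - 1, by omega⟩ : Fin n) : ℕ) + 1
  else if i = 0 then 0 else n + 1

/-- The set of pairs `(i,j)` with `i, j ∈ [1,n]`. -/
def pairs (n : ℕ) : Finset (ℕ × ℕ) := Finset.Icc 1 n ×ˢ Finset.Icc 1 n

/-- `des σ = #{i ∈ [n−1] : σ(i) > σ(i+1)}`. -/
def desStat (n : ℕ) (σ : Equiv.Perm (Fin n)) : ℕ :=
  ((Finset.Icc 1 (n - 1)).filter fun i => pext n σ (i + 1) < pext n σ i).card

/-- `les σ = #{(i,j) : 2 ≤ i < j ≤ n, σ(i−1) > σ(j) > σ(i)}`. -/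
def lesStat (n : ℕ) (σ : Equiv.Perm (Fin n)) : ℕ :=
  ((pairs n).filter fun x => 2 ≤ x.1 ∧ x.1 < x.2 ∧
    pext n σ x.1 < pext n σ x.2 ∧ pext n σ x.2 < pext n σ (x.1 - 1)).card

/-- `less σ = #{(i,j) : 2 ≤ i < j ≤ n, σ(i−1) < σ(j) < σ(i)}`. -/
def lessStat (n : ℕ) (σ : Equiv.Perm (Fin n)) : ℕ :=
  ((pairs n).filter fun x => 2 ≤ x.1 ∧ x.1 < x.2 ∧
    pext n σ (x.1 - 1) < pext n σ x.2 ∧ pext n σ x.2 < pext n σ x.1).card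

/-- `res σ = #{(i,j) : 1 ≤ i < j ≤ n−1, σ(j+1) > σ(i) > σ(j)}`. -/
def resStat (n : ℕ) (σ : Equiv.Perm (Fin n)) : ℕ :=
  ((pairs n).filter fun x => x.1 < x.2 ∧ x.2 ≤ n - 1 ∧
    pext n σ x.2 < pext n σ x.1 ∧ pext n σ x.1 < pext n σ (x.2 + 1)).card

/-- `ress σ = #{(i,j) : 1 ≤ i < j ≤ n−1, σ(j+1) < σ(i) < σ(j)}`. -/
def ressStat (n : ℕ) (σ : Equiv.Perm (Fin n)) : ℕ :=
  ((pairs n).filter fun x => x.1 < x.2 ∧ x.2 ≤ n - 1 ∧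
    pext n σ (x.2 + 1) < pext n σ x.1 ∧ pext n σ x.1 < pext n σ x.2).card

/-! Linear statistics with the boundary convention `σ(0)=σ(n+1)=0` (starred). -/

def peakStar (n : ℕ) (σ : Equiv.Perm (Fin n)) : ℕ :=
  ((Finset.Icc 1 n).filter fun i =>
    pext n σ (i - 1) < pext n σ i ∧ pext n σ (i + 1) < pext n σ i).card

def valleyStar (n : ℕ) (σ : Equiv.Perm (Fin n)) : ℕ :=
  ((Finset.Icc 1 n).filter fun i =>
    pext n σ i < pext n σ (i - 1) ∧ pext n σ i < pext n σ (i + 1)).card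

def daStar (n : ℕ) (σ : Equiv.Perm (Fin n)) : ℕ :=
  ((Finset.Icc 1 n).filter fun i =>
    pext n σ (i - 1) < pext n σ i ∧ pext n σ i < pext n σ (i + 1)).card

def ddStar (n : ℕ) (σ : Equiv.Perm (Fin n)) : ℕ :=
  ((Finset.Icc 1 n).filter fun i =>
    pext n σ (i + 1) < pext n σ i ∧ pext n σ i < pext n σ (i - 1)).card

/-! Linear statistics with the Brändén boundary convention `σ(0)=σ(n+1)=n+1`. -/

def peakB (n : ℕ) (σ : Equiv.Perm (Fin n)) : ℕ :=
  ((Finset.Icc 1 n).filter fun i =>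
    pextB n σ (i - 1) < pextB n σ i ∧ pextB n σ (i + 1) < pextB n σ i).card

def valleyB (n : ℕ) (σ : Equiv.Perm (Fin n)) : ℕ :=
  ((Finset.Icc 1 n).filter fun i =>
    pextB n σ i < pextB n σ (i - 1) ∧ pextB n σ i < pextB n σ (i + 1)).card

def daB (n : ℕ) (σ : Equiv.Perm (Fin n)) : ℕ :=
  ((Finset.Icc 1 n).filter fun i =>
    pextB n σ (i - 1) < pextB n σ i ∧ pextB n σ i < pextB n σ (i + 1)).card

def ddB (n : ℕ) (σ : Equiv.Perm (Fin n)) : ℕ :=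
  ((Finset.Icc 1 n).filter fun i =>
    pextB n σ (i + 1) < pextB n σ i ∧ pextB n σ i < pextB n σ (i - 1)).card

/-! Linear statistics with the boundary convention `σ(0)=0`, `σ(n+1)=n+1`. -/

def valleyC (n : ℕ) (σ : Equiv.Perm (Fin n)) : ℕ :=
  ((Finset.Icc 1 n).filter fun i =>
    pextC n σ i < pextC n σ (i - 1) ∧ pextC n σ i < pextC n σ (i + 1)).card

def daC (n : ℕ) (σ : Equiv.Perm (Fin n)) : ℕ :=
  ((Finset.Icc 1 n).filter fun i =>
    pextC n σ (i - 1) < pextC n σ i ∧ pextC n σ i < pextC n σ (i + 1)).card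

def ddC (n : ℕ) (σ : Equiv.Perm (Fin n)) : ℕ :=
  ((Finset.Icc 1 n).filter fun i =>
    pextC n σ (i + 1) < pextC n σ i ∧ pextC n σ i < pextC n σ (i - 1)).card

/-- `fmax σ`: the number of double ascents (convention `σ(0)=0`, `σ(n+1)=n+1`)
which are left-to-right maxima. -/
def fmaxStat (n : ℕ) (σ : Equiv.Perm (Fin n)) : ℕ :=
  ((Finset.Icc 1 n).filter fun i =>
    pextC n σ (i - 1) < pextC n σ i ∧ pextC n σ i < pextC n σ (i + 1) ∧
    ∀ j ∈ Finset.Ico 1 i, pext n σ j < pext n σ i).card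

/-! Cyclic statistics. -/

def excStat (n : ℕ) (σ : Equiv.Perm (Fin n)) : ℕ :=
  ((Finset.Icc 1 n).filter fun i => i < pext n σ i).card

def wexStat (n : ℕ) (σ : Equiv.Perm (Fin n)) : ℕ :=
  ((Finset.Icc 1 n).filter fun i => i ≤ pext n σ i).card

def dropStat (n : ℕ) (σ : Equiv.Perm (Fin n)) : ℕ :=
  ((Finset.Icc 1 n).filter fun i => pext n σ i < i).card

def fixStat (n : ℕ) (σ : Equiv.Perm (Fin n)) : ℕ :=
  ((Finset.Icc 1 n).filter fun i => pext n σ i = i).card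

/-- cyclic valleys: `x` with `σ⁻¹(x) > x < σ(x)`. -/
def cvalleyStat (n : ℕ) (σ : Equiv.Perm (Fin n)) : ℕ :=
  ((Finset.Icc 1 n).filter fun x => x < pext n σ⁻¹ x ∧ x < pext n σ x).card

/-- double excedances: `x` with `σ⁻¹(x) < x < σ(x)`. -/
def cdaStat (n : ℕ) (σ : Equiv.Perm (Fin n)) : ℕ :=
  ((Finset.Icc 1 n).filter fun x => pext n σ⁻¹ x < x ∧ x < pext n σ x).card

/-- double drops: `x` with `σ⁻¹(x) > x > σ(x)`. -/
def cddStat (n : ℕ) (σ : Equiv.Perm (Fin n)) : ℕ :=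
  ((Finset.Icc 1 n).filter fun x => x < pext n σ⁻¹ x ∧ pext n σ x < x).card

/-- crossings. -/
def crosStat (n : ℕ) (σ : Equiv.Perm (Fin n)) : ℕ :=
  ((pairs n).filter fun x =>
    (x.1 < x.2 ∧ x.2 ≤ pext n σ x.1 ∧ pext n σ x.1 < pext n σ x.2) ∨
    (x.2 < x.1 ∧ pext n σ x.1 < x.2 ∧ pext n σ x.2 < pext n σ x.1)).card

/-- nestings. -/
def nestStat (n : ℕ) (σ : Equiv.Perm (Fin n)) : ℕ :=
  ((pairs n).filter fun x =>
    (x.1 < x.2 ∧ x.2 ≤ pext n σ x.2 ∧ pext n σ x.2 < pext n σ x.1) ∨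
    (x.2 < x.1 ∧ pext n σ x.2 < x.2 ∧ pext n σ x.1 < pext n σ x.2)).card

/-- number of cycles of `σ` (fixed points count as cycles). -/
def cycStat (n : ℕ) (σ : Equiv.Perm (Fin n)) : ℕ :=
  Multiset.card σ.cycleType + (Finset.univ.filter fun x => σ x = x).card

/-! Star statistics: `σ*(i) = σ(i) − 1`, a bijection `[n] → {0,…,n−1}`;
we extend `σ*` by `0` outside `[1,n]`. -/

def starf (n : ℕ) (σ : Equiv.Perm (Fin n)) (i : ℕ) : ℕ :=
  if 1 ≤ i ∧ i ≤ n then pext n σ i - 1 else 0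

/-- `(σ*)⁻¹(i) = σ⁻¹(i+1)`, defined for `0 ≤ i ≤ n−1`. -/
def invstarf (n : ℕ) (σ : Equiv.Perm (Fin n)) (i : ℕ) : ℕ :=
  pext n σ⁻¹ (i + 1)

def dropStarStat (n : ℕ) (σ : Equiv.Perm (Fin n)) : ℕ :=
  ((Finset.Icc 1 n).filter fun i => starf n σ i < i).card

def fixStarStat (n : ℕ) (σ : Equiv.Perm (Fin n)) : ℕ :=
  ((Finset.Icc 1 n).filter fun i => starf n σ i = i).card

def wexStarStat (n : ℕ) (σ : Equiv.Perm (Fin n)) : ℕ :=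
  ((Finset.Icc 1 n).filter fun i => i ≤ starf n σ i).card

def cdaStarStat (n : ℕ) (σ : Equiv.Perm (Fin n)) : ℕ :=
  ((Finset.Icc 1 n).filter fun i => invstarf n σ i < i ∧ i < starf n σ i).card

def cddStarStat (n : ℕ) (σ : Equiv.Perm (Fin n)) : ℕ :=
  ((Finset.Icc 1 n).filter fun i => i < invstarf n σ i ∧ starf n σ i < i).card

def cvalleyStarStat (n : ℕ) (σ : Equiv.Perm (Fin n)) : ℕ :=
  ((Finset.Icc 1 n).filter fun i => i < invstarf n σ i ∧ i < starf n σ i).card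

def crosStarStat (n : ℕ) (σ : Equiv.Perm (Fin n)) : ℕ :=
  ((pairs n).filter fun x =>
    (x.1 < x.2 ∧ x.2 ≤ starf n σ x.1 ∧ starf n σ x.1 < starf n σ x.2) ∨
    (x.2 < x.1 ∧ starf n σ x.1 < x.2 ∧ starf n σ x.2 < starf n σ x.1)).card

def nestStarStat (n : ℕ) (σ : Equiv.Perm (Fin n)) : ℕ :=
  ((pairs n).filter fun x =>
    (x.1 < x.2 ∧ x.2 ≤ starf n σ x.2 ∧ starf n σ x.2 < starf n σ x.1) ∨
    (x.2 < x.1 ∧ starf n σ x.2 < x.2 ∧ starf n σ x.1 < starf n σ x.2)).card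

/-- `cyc* σ`: the number of cycles of the functional digraph of `σ*` on `[n]`,
counted as the number of `i ∈ [1,n]` that lie on a cycle of `σ*` and are
minimal in their cycle. (The component of `σ*` that is a path from `n` to `0`
contributes no such `i`.) -/
def cycStarStat (n : ℕ) (σ : Equiv.Perm (Fin n)) : ℕ :=
  ((Finset.Icc 1 n).filter fun i =>
    (∃ m ∈ Finset.Icc 1 n, (starf n σ)^[m] i = i) ∧
    ∀ m ∈ Finset.range (n + 1), i ≤ (starf n σ)^[m] i).card

/-! Motzkin paths, encoded as step sequences `γ : Fin m → Fin 3`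
(`0` = up step `(1,1)`, `1` = level step `(1,0)`, `2` = down step `(1,−1)`). -/

/-- The height (ordinate) of the path after `i` steps. -/
def hgt (m : ℕ) (γ : Fin m → Fin 3) (i : ℕ) : ℤ :=
  ∑ j ∈ Finset.range i, if hj : j < m then 1 - ((γ ⟨j, hj⟩ : ℕ) : ℤ) else 0

/-- A step sequence is a Motzkin path if it never goes below the x-axis and
ends at height `0`. -/
def IsMotzkin (m : ℕ) (γ : Fin m → Fin 3) : Prop :=
  (∀ i ≤ m, 0 ≤ hgt m γ i) ∧ hgt m γ m = 0

/-- The (finite) set of Motzkin paths of length `m`. -/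
def motzkin (m : ℕ) : Finset (Fin m → Fin 3) :=
  Finset.univ.filter fun γ => IsMotzkin m γ

/-- number of up (North-East) steps. -/
def neCount (m : ℕ) (γ : Fin m → Fin 3) : ℕ :=
  (Finset.univ.filter fun i => γ i = 0).card

/-- number of level (East) steps. -/
def eCount (m : ℕ) (γ : Fin m → Fin 3) : ℕ :=
  (Finset.univ.filter fun i => γ i = 1).card

/-- the `(p,q)`-integer `[m]_{p,q} = p^{m−1} + p^{m−2}q + ⋯ + q^{m−1}`. -/
def pqInt {R : Type*} [CommRing R] (p q : R) (m : ℕ) : R :=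
  ∑ j ∈ Finset.range m, p ^ (m - 1 - j) * q ^ j

/-- `d_{n,k}(β) ∈ ℤ[β]`: the sum of `β^{cyc* σ − fix* σ}` over permutations
of `[n]` with `cvalley* σ = k` and `cdd* σ = 0`. -/
def dPoly1 (n k : ℕ) : Polynomial ℤ :=
  ∑ σ ∈ Finset.univ.filter
      (fun σ : Equiv.Perm (Fin n) =>
        cvalleyStarStat n σ = k ∧ cddStarStat n σ = 0),
    Polynomial.X ^ (cycStarStat n σ - fixStarStat n σ)

lemma starf_val_add_one {n : ℕ} (σ : Equiv.Perm (Fin n)) (j : Fin n) :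
    starf n σ (j + 1) = σ j := by
  have h : 1 ≤ (j : ℕ) + 1 ∧ (j : ℕ) + 1 ≤ n := ⟨by omega, j.2⟩
  simp [starf, pext, j.2]

lemma invstarf_val {n : ℕ} (σ : Equiv.Perm (Fin n)) (j : Fin n) :
    invstarf n σ j = (σ⁻¹ j : Fin n) + 1 := by
  simp [invstarf, pext, j.2]

lemma invstarf_of_le {n : ℕ} (σ : Equiv.Perm (Fin n)) {i : ℕ} (hi : n ≤ i) :
    invstarf n σ i = 0 := by
  simp [invstarf, pext, Nat.not_lt.2 hi]

lemma exists_fin_of_mem_Icc {n i : ℕ} (hi : i ∈ Finset.Icc 1 n) :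
    ∃ j : Fin n, i = j + 1 := by
  rw [Finset.mem_Icc] at hi
  exact ⟨⟨i - 1, by omega⟩, by simp; omega⟩

/-- The closure of `σ*` to a permutation of `{0,…,n}`, obtained by sending `0` to `n`. -/
def starPerm {n : ℕ} (σ : Equiv.Perm (Fin n)) : Equiv.Perm (Fin (n + 1)) where
  toFun := Fin.cases (Fin.last n) fun j => (σ j).castSucc
  invFun := Fin.lastCases 0 fun j => (σ⁻¹ j).succ
  left_inv x := by refine Fin.cases ?_ (fun j => ?_) x <;> simp
  right_inv x := by refine Fin.lastCases ?_ (fun j => ?_) x <;> simp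

@[simp]
lemma starPerm_zero {n : ℕ} (σ : Equiv.Perm (Fin n)) : starPerm σ 0 = Fin.last n := rfl

@[simp]
lemma starPerm_succ {n : ℕ} (σ : Equiv.Perm (Fin n)) (j : Fin n) :
    starPerm σ j.succ = (σ j).castSucc := rfl

lemma starf_eq_starPerm {n : ℕ} (σ : Equiv.Perm (Fin n)) {x : Fin (n + 1)} (hx : x ≠ 0) :
    starf n σ x = starPerm σ x := by
  obtain ⟨j, rfl⟩ := Fin.exists_succ_eq.2 hx
  simp [starf_val_add_one]

lemma starPerm_mul_swap {n : ℕ} (σ : Equiv.Perm (Fin n)) (q r : Fin n) :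
    starPerm (σ * Equiv.swap q r) = starPerm σ * Equiv.swap q.succ r.succ := by
  ext x
  refine Fin.cases ?_ (fun j => ?_) x
  · rw [Equiv.Perm.mul_apply, Equiv.swap_apply_of_ne_of_ne] <;>
      simp [(Fin.succ_ne_zero _).symm]
  · simp only [Equiv.Perm.mul_apply, starPerm_succ, Equiv.swap_apply_def, Fin.succ_inj]
    split_ifs <;> simp

/-- The nontrivial cycles of a permutation are counted by their minima. -/
lemma card_cycleType_eq_card_minima {n : ℕ} (τ : Equiv.Perm (Fin n)) :
    Multiset.card τ.cycleType =
      (univ.filter fun x => τ x ≠ x ∧ ∀ y, τ.SameCycle x y → x ≤ y).card := by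
  rw [Equiv.Perm.cycleType_def, Multiset.card_map]
  symm
  refine Finset.card_bij (fun x _ => τ.cycleOf x) ?_ ?_ ?_
  · intro x hx
    rw [Equiv.Perm.cycleOf_mem_cycleFactorsFinset_iff, Equiv.Perm.mem_support]
    exact (Finset.mem_filter.1 hx).2.1
  · intro x hx y hy hxy
    rw [Finset.mem_filter] at hx hy
    have hc : τ.SameCycle x y :=
      (Equiv.Perm.sameCycle_iff_cycleOf_eq_of_mem_support
        (Equiv.Perm.mem_support.2 hx.2.1) (Equiv.Perm.mem_support.2 hy.2.1)).2 hxy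
    exact le_antisymm (hx.2.2 y hc) (hy.2.2 x hc.symm)
  · intro c hc
    have hne : c.support.Nonempty :=
      Finset.nonempty_iff_ne_empty.2 fun h =>
        (Equiv.Perm.mem_cycleFactorsFinset_iff.1 hc).1.ne_one
          (Equiv.Perm.support_eq_empty_iff.1 h)
    have hmem := c.support.min'_mem hne
    have hcyc := Equiv.Perm.cycle_is_cycleOf hmem hc
    have hmove : τ (c.support.min' hne) ≠ c.support.min' hne :=
      Equiv.Perm.mem_support.1 (Equiv.Perm.mem_cycleFactorsFinset_support_le hc hmem)
    refine ⟨c.support.min' hne, ?_, hcyc.symm⟩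
    refine Finset.mem_filter.2 ⟨Finset.mem_univ _, hmove, fun y hy => ?_⟩
    refine Finset.min'_le _ _ ?_
    rw [hcyc]
    exact (Equiv.Perm.mem_support_cycleOf_iff' hmove).2 hy

lemma iterate_starf_eq_pow {n : ℕ} (σ : Equiv.Perm (Fin n)) (x : Fin (n + 1)) (M : ℕ)
    (h : ∀ m < M, (starf n σ)^[m] x ≠ 0 ∨ (starPerm σ ^ m) x ≠ 0) :
    (starf n σ)^[M] x = ((starPerm σ ^ M) x : Fin (n + 1)) := by
  induction M with
  | zero => simp
  | succ M ih =>
    have hM := ih fun m hm => h m (by omega)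
    have hne : (starPerm σ ^ M) x ≠ 0 := by
      rcases h M (by omega) with h0 | h0
      · intro h1
        rw [hM, h1] at h0
        simp at h0
      · exact h0
    rw [Function.iterate_succ_apply', hM, starf_eq_starPerm σ hne, pow_succ',
      Equiv.Perm.mul_apply]

/-- A non-fixed `x` is a minimum of a cycle of `σ*` iff it is a minimum of a cycle of
the closure `starPerm σ`. -/
lemma cycle_minimum_iff {n : ℕ} (σ : Equiv.Perm (Fin n)) {x : Fin (n + 1)} (hx : x ≠ 0)
    (hmove : starPerm σ x ≠ x) :
    ((∃ m ∈ Finset.Icc 1 n, (starf n σ)^[m] x = x) ∧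
      ∀ m ∈ Finset.range (n + 1), (x : ℕ) ≤ (starf n σ)^[m] x) ↔
    ∀ y, (starPerm σ).SameCycle x y → x ≤ y := by
  have hpos : 0 < (x : ℕ) := Nat.pos_of_ne_zero fun h => hx (Fin.ext h)
  constructor
  · rintro ⟨⟨m, hm, hper⟩, hle⟩ y hy
    rw [Finset.mem_Icc] at hm
    have hiter : ∀ j ≤ n, (starf n σ)^[j] x = ((starPerm σ ^ j) x : Fin (n + 1)) := by
      intro j hj
      refine iterate_starf_eq_pow σ x j fun i hi => Or.inl ?_
      have := hle i (Finset.mem_range.2 (by omega))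
      omega
    obtain ⟨j, rfl⟩ := hy.exists_nat_pow_eq
    have hfix : (starPerm σ ^ m) x = x := Fin.ext (by rw [← hiter m hm.2, hper])
    have hred : (starPerm σ ^ j) x = (starPerm σ ^ (j % m)) x := by
      conv_lhs => rw [← Nat.mod_add_div j m]
      rw [pow_add, pow_mul, Equiv.Perm.mul_apply,
        Equiv.Perm.pow_apply_eq_self_of_apply_eq_self hfix]
    have hlt : j % m < m := Nat.mod_lt _ (by omega)
    rw [hred, Fin.le_def, ← hiter _ (by omega)]
    exact hle _ (Finset.mem_range.2 (by omega))
  · intro hmin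
    have hpow : ∀ m, x ≤ (starPerm σ ^ m) x := fun m => hmin _ ⟨m, by simp⟩
    have hiter : ∀ j, (starf n σ)^[j] x = ((starPerm σ ^ j) x : Fin (n + 1)) := by
      intro j
      refine iterate_starf_eq_pow σ x j fun i _ => Or.inr fun h => ?_
      have := hpow i
      rw [h] at this
      exact hx (Fin.le_zero_iff.1 this)
    refine ⟨?_, fun m _ => by rw [hiter]; exact hpow m⟩
    have hcyc := Equiv.Perm.isCycle_cycleOf (starPerm σ) hmove
    have hx_supp : x ∈ ((starPerm σ).cycleOf x).support :=
      (Equiv.Perm.mem_support_cycleOf_iff' hmove).2 (Equiv.Perm.SameCycle.refl _ _)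
    have hzero : (0 : Fin (n + 1)) ∉ ((starPerm σ).cycleOf x).support := fun h =>
      hx (Fin.le_zero_iff.1 (hmin 0 ((Equiv.Perm.mem_support_cycleOf_iff' hmove).1 h)))
    have hcard : ((starPerm σ).cycleOf x).support.card ≤ n := by
      have := Finset.card_lt_univ_of_notMem hzero
      rw [Fintype.card_fin] at this
      omega
    refine ⟨_, Finset.mem_Icc.2 ⟨Finset.card_pos.2 ⟨x, hx_supp⟩, hcard⟩, ?_⟩
    rw [hiter, ← Equiv.Perm.cycleOf_pow_apply_self, ← hcyc.orderOf, pow_orderOf_eq_one,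
      Equiv.Perm.one_apply]

lemma cycStar_sub_fixStar_add_one {n : ℕ} (hn : 1 ≤ n) (σ : Equiv.Perm (Fin n)) :
    cycStarStat n σ - fixStarStat n σ + 1 = Multiset.card (starPerm σ).cycleType := by
  obtain ⟨A, hA, hmemA⟩ : ∃ A : Finset ℕ, cycStarStat n σ = A.card ∧ ∀ i, i ∈ A ↔
      i ∈ Finset.Icc 1 n ∧ (∃ m ∈ Finset.Icc 1 n, (starf n σ)^[m] i = i) ∧
        ∀ m ∈ Finset.range (n + 1), i ≤ (starf n σ)^[m] i :=
    ⟨_, rfl, fun i => by simp only [Finset.mem_filter]⟩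
  rw [card_cycleType_eq_card_minima, hA, fixStarStat]
  have hsub : ((Finset.Icc 1 n).filter fun i => starf n σ i = i) ⊆ A := by
    intro i hi
    rw [Finset.mem_filter] at hi
    refine (hmemA i).2 ⟨hi.1, ⟨1, Finset.mem_Icc.2 ⟨le_rfl, hn⟩, hi.2⟩, fun m _ => ?_⟩
    rw [Function.iterate_fixed hi.2]
  rw [← Finset.card_sdiff_of_subset hsub]
  have hzero : (0 : Fin (n + 1)) ∈ univ.filter fun x => starPerm σ x ≠ x ∧
      ∀ y, (starPerm σ).SameCycle x y → x ≤ y := by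
    refine Finset.mem_filter.2 ⟨Finset.mem_univ _, ?_, fun y _ => Fin.zero_le y⟩
    rw [starPerm_zero]
    intro h
    have := congrArg Fin.val h
    simp at this
    omega
  rw [← Finset.card_erase_add_one hzero]
  congr 1
  symm
  refine Finset.card_bij (fun x _ => (x : ℕ)) ?_ (fun x _ y _ h => Fin.ext h) ?_
  · intro x hx
    simp only [Finset.mem_erase, Finset.mem_filter, Finset.mem_univ, true_and] at hx
    obtain ⟨hx0, hmove, hmin⟩ := hx
    have hxI : (x : ℕ) ∈ Finset.Icc 1 n := by
      have : (x : ℕ) ≠ 0 := fun h => hx0 (Fin.ext h)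
      rw [Finset.mem_Icc]
      omega
    rw [Finset.mem_sdiff, hmemA, Finset.mem_filter]
    refine ⟨⟨hxI, (cycle_minimum_iff σ hx0 hmove).2 hmin⟩, fun h => hmove (Fin.ext ?_)⟩
    rw [← starf_eq_starPerm σ hx0, h.2]
  · intro i hi
    rw [Finset.mem_sdiff, hmemA, Finset.mem_filter] at hi
    obtain ⟨⟨hI, hmin⟩, hnot⟩ := hi
    have hI' := Finset.mem_Icc.1 hI
    obtain ⟨x, rfl⟩ : ∃ x : Fin (n + 1), (x : ℕ) = i := ⟨⟨i, by omega⟩, rfl⟩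
    have hx0 : x ≠ 0 := by
      rintro rfl
      simp at hI'
    have hmove : starPerm σ x ≠ x := fun h =>
      hnot ⟨hI, by rw [starf_eq_starPerm σ hx0, h]⟩
    refine ⟨x, ?_, rfl⟩
    rw [Finset.mem_erase, Finset.mem_filter]
    exact ⟨hx0, Finset.mem_univ _, hmove, (cycle_minimum_iff σ hx0 hmove).1 hmin⟩

lemma mul_swap_apply_cases {n : ℕ} (σ : Equiv.Perm (Fin n)) {q r : Fin n} (j : Fin n) :
    (σ * Equiv.swap q r) j = σ j ∨
      (j = q ∧ (σ * Equiv.swap q r) j = σ r) ∨ (j = r ∧ (σ * Equiv.swap q r) j = σ q) := by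
  simp only [Equiv.Perm.mul_apply, Equiv.swap_apply_def]
  split_ifs with h1 h2 <;> simp_all

lemma mul_swap_inv_apply_cases {n : ℕ} (σ : Equiv.Perm (Fin n)) {q r : Fin n} (j : Fin n) :
    (σ * Equiv.swap q r)⁻¹ j = σ⁻¹ j ∨
      (j = σ q ∧ σ⁻¹ j = q ∧ (σ * Equiv.swap q r)⁻¹ j = r) ∨
      (j = σ r ∧ σ⁻¹ j = r ∧ (σ * Equiv.swap q r)⁻¹ j = q) := by
  obtain ⟨i, rfl⟩ := σ.surjective j
  simp only [mul_inv_rev, Equiv.Perm.mul_apply, Equiv.Perm.inv_def, Equiv.symm_apply_apply,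
    Equiv.symm_swap, Equiv.swap_apply_def, σ.injective.eq_iff]
  split_ifs with h1 h2 <;> simp_all

/-- Exchanging the values of two drops, each lying above both values, does not change how
`σ*(i)` compares with `i`. -/
lemma compare_starf_mul_swap {n : ℕ} {σ : Equiv.Perm (Fin n)} {q r : Fin n}
    (hqq : σ q ≤ q) (hqr : σ q ≤ r) (hrq : σ r ≤ q) (hrr : σ r ≤ r) {i : ℕ} (hi : i ∈ Finset.Icc 1 n) :
    (starf n (σ * Equiv.swap q r) i < i ↔ starf n σ i < i) ∧
      (i < starf n (σ * Equiv.swap q r) i ↔ i < starf n σ i) := by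
  obtain ⟨j, rfl⟩ := exists_fin_of_mem_Icc hi
  rw [starf_val_add_one, starf_val_add_one]
  rw [Fin.le_def] at hqq hqr hrq hrr
  rcases mul_swap_apply_cases σ (q := q) (r := r) j with h | ⟨rfl, h⟩ | ⟨rfl, h⟩ <;>
    rw [h] <;> omega

/-- Exchanging the values of two drops, each lying above both values, does not change
whether `i` is smaller than its preimage. -/
lemma lt_invstarf_mul_swap {n : ℕ} {σ : Equiv.Perm (Fin n)} {q r : Fin n}
    (hqq : σ q ≤ q) (hqr : σ q ≤ r) (hrq : σ r ≤ q) (hrr : σ r ≤ r) (i : ℕ) :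
    i < invstarf n (σ * Equiv.swap q r) i ↔ i < invstarf n σ i := by
  rcases lt_or_ge i n with hi | hi
  · obtain ⟨j, rfl⟩ : ∃ j : Fin n, (j : ℕ) = i := ⟨⟨i, hi⟩, rfl⟩
    rw [invstarf_val, invstarf_val]
    rw [Fin.le_def] at hqq hqr hrq hrr
    rcases mul_swap_inv_apply_cases σ (q := q) (r := r) j with h | ⟨h, h', h''⟩ | ⟨h, h', h''⟩
    · rw [h]
    all_goals rw [h', h'', h]; omega
  · rw [invstarf_of_le _ hi, invstarf_of_le _ hi]

lemma cvalleyStarStat_mul_swap {n : ℕ} {σ : Equiv.Perm (Fin n)} {q r : Fin n}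
    (hqq : σ q ≤ q) (hqr : σ q ≤ r) (hrq : σ r ≤ q) (hrr : σ r ≤ r) :
    cvalleyStarStat n (σ * Equiv.swap q r) = cvalleyStarStat n σ := by
  refine congrArg Finset.card (Finset.filter_congr fun i hi => ?_)
  rw [lt_invstarf_mul_swap hqq hqr hrq hrr, (compare_starf_mul_swap hqq hqr hrq hrr hi).2]

lemma cddStarStat_mul_swap {n : ℕ} {σ : Equiv.Perm (Fin n)} {q r : Fin n}
    (hqq : σ q ≤ q) (hqr : σ q ≤ r) (hrq : σ r ≤ q) (hrr : σ r ≤ r) :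
    cddStarStat n (σ * Equiv.swap q r) = cddStarStat n σ := by
  refine congrArg Finset.card (Finset.filter_congr fun i hi => ?_)
  rw [lt_invstarf_mul_swap hqq hqr hrq hrr, (compare_starf_mul_swap hqq hqr hrq hrr hi).1]

lemma support_starPerm_mul_swap {n : ℕ} {σ : Equiv.Perm (Fin n)} {q r : Fin n}
    (hqq : σ q ≤ q) (hqr : σ q ≤ r) (hrq : σ r ≤ q) (hrr : σ r ≤ r) :
    (starPerm (σ * Equiv.swap q r)).support = (starPerm σ).support := by
  ext x
  rw [Equiv.Perm.mem_support, Equiv.Perm.mem_support]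
  refine not_congr ?_
  refine Fin.cases (by simp) (fun j => ?_) x
  have h := compare_starf_mul_swap hqq hqr hrq hrr
    (Finset.mem_Icc.2 ⟨by omega, j.2⟩ : (j : ℕ) + 1 ∈ Finset.Icc 1 n)
  rw [starf_val_add_one, starf_val_add_one] at h
  simp only [Fin.ext_iff, starPerm_succ, Fin.val_castSucc, Fin.val_succ]
  omega

lemma neg_one_pow_mul_swap {n : ℕ} {σ : Equiv.Perm (Fin n)} {q r : Fin n}
    (hqq : σ q ≤ q) (hqr : σ q ≤ r) (hrq : σ r ≤ q) (hrr : σ r ≤ r) (hne : q ≠ r) :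
    (-1 : ℤ) ^ (cycStarStat n (σ * Equiv.swap q r) - fixStarStat n (σ * Equiv.swap q r)) =
      -(-1) ^ (cycStarStat n σ - fixStarStat n σ) := by
  have hn : 1 ≤ n := by have := q.2; omega
  have hsign : Equiv.Perm.sign (starPerm (σ * Equiv.swap q r)) =
      -Equiv.Perm.sign (starPerm σ) := by
    rw [starPerm_mul_swap, Equiv.Perm.sign_mul,
      Equiv.Perm.sign_swap ((Fin.succ_injective n).ne hne), mul_neg_one]
  rw [Equiv.Perm.sign_of_cycleType, Equiv.Perm.sign_of_cycleType, Equiv.Perm.sum_cycleType,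
    Equiv.Perm.sum_cycleType, support_starPerm_mul_swap hqq hqr hrq hrr,
    ← cycStar_sub_fixStar_add_one hn, ← cycStar_sub_fixStar_add_one hn] at hsign
  simp only [pow_add, pow_one, mul_neg, mul_one, neg_neg] at hsign
  rw [← mul_neg] at hsign
  have := congrArg Units.val (mul_left_cancel hsign)
  rw [← neg_eq_iff_eq_neg]
  simpa using this

/-- The drops of `σ*` other than the one at `n`, shifted to `Fin n`. -/
def innerDrops {m : ℕ} (σ : Equiv.Perm (Fin (m + 1))) : Finset (Fin (m + 1)) :=
  univ.filter fun j => j < Fin.last m ∧ σ j ≤ j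

/-- The largest drop of `σ*` other than the one at `n`, shifted to `Fin n`. -/
def lastInnerDrop {m : ℕ} (σ : Equiv.Perm (Fin (m + 1))) : Fin (m + 1) :=
  (innerDrops σ).sup id

lemma exists_innerDrop_ge {m : ℕ} {σ : Equiv.Perm (Fin (m + 1))}
    (hv : cvalleyStarStat (m + 1) σ ≠ 0) (hdd : cddStarStat (m + 1) σ = 0) :
    ∃ j ∈ innerDrops σ, σ (Fin.last m) ≤ j := by
  rcases eq_or_ne (σ (Fin.last m)) 0 with h0 | h0
  · obtain ⟨i, hi⟩ := Finset.card_ne_zero.1 hv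
    rw [Finset.mem_filter, Finset.mem_Icc] at hi
    obtain ⟨⟨hi1, -⟩, hinv, -⟩ := hi
    have him : i < m + 1 := by
      by_contra h
      rw [invstarf_of_le σ (by omega)] at hinv
      omega
    obtain ⟨w, rfl⟩ : ∃ w : Fin (m + 1), (w : ℕ) = i := ⟨⟨i, him⟩, rfl⟩
    rw [invstarf_val] at hinv
    refine ⟨σ⁻¹ w, Finset.mem_filter.2 ⟨Finset.mem_univ _, ?_, ?_⟩, by simp [h0]⟩
    · refine lt_of_le_of_ne (Fin.le_last _) fun h => ?_
      rw [Equiv.Perm.inv_eq_iff_eq, h0] at h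
      simp [h] at hi1
    · rw [Equiv.Perm.inv_def] at hinv ⊢
      rw [Equiv.apply_symm_apply, Fin.le_def]
      omega
  · obtain ⟨v, hvs⟩ := Fin.exists_succ_eq.2 h0
    have hvval : ((σ (Fin.last m) : Fin (m + 1)) : ℕ) = v + 1 := by rw [← hvs]; simp
    obtain ⟨j, hj, hvj, hdrop⟩ : ∃ j < Fin.last m, v.castSucc ≤ j ∧ σ j ≤ j := by
      by_contra! hcon
      have hmaps : ∀ j ∈ Finset.Ici v.castSucc, σ j ∈ Finset.Ici v.succ := by
        intro j hj
        rw [Finset.mem_Ici] at hj ⊢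
        rcases (Fin.le_last j).lt_or_eq with hlt | rfl
        · have := hcon j hlt hj
          rw [Fin.lt_def] at this
          rw [Fin.le_def] at hj ⊢
          simp only [Fin.val_castSucc, Fin.val_succ] at *
          omega
        · exact hvs.le
      have hcard := Finset.card_le_card_of_injOn σ hmaps σ.injective.injOn
      rw [Fin.card_Ici, Fin.card_Ici] at hcard
      simp only [Fin.val_castSucc, Fin.val_succ] at hcard
      have := v.2
      omega
    refine ⟨j, Finset.mem_filter.2 ⟨Finset.mem_univ _, hj, hdrop⟩, ?_⟩
    by_contra hlt
    have hjv : j = v.castSucc := by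
      rw [Fin.le_def] at hlt hvj
      ext
      simp only [Fin.val_castSucc] at *
      omega
    subst hjv
    refine Finset.card_ne_zero.2 ⟨(v : ℕ) + 1, ?_⟩ hdd
    have h1 := starf_val_add_one σ v.castSucc
    have h2 := invstarf_val σ v.succ
    have h3 : σ⁻¹ v.succ = Fin.last m := by rw [hvs, Equiv.Perm.inv_def, Equiv.symm_apply_apply]
    rw [h3] at h2
    rw [Fin.le_def] at hdrop
    have := v.2
    simp only [Fin.val_castSucc, Fin.val_succ, Fin.val_last] at *
    rw [Finset.mem_filter, Finset.mem_Icc, h1, h2]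
    omega

lemma lastInnerDrop_spec {m : ℕ} {σ : Equiv.Perm (Fin (m + 1))}
    (hv : cvalleyStarStat (m + 1) σ ≠ 0) (hdd : cddStarStat (m + 1) σ = 0) :
    lastInnerDrop σ < Fin.last m ∧ σ (lastInnerDrop σ) ≤ lastInnerDrop σ ∧
      σ (Fin.last m) ≤ lastInnerDrop σ := by
  obtain ⟨j, hj, hle⟩ := exists_innerDrop_ge hv hdd
  obtain ⟨q, hq, hsup⟩ := Finset.exists_mem_eq_sup _ ⟨j, hj⟩ (id : Fin (m + 1) → Fin (m + 1))
  have hmem : lastInnerDrop σ ∈ innerDrops σ := by rwa [lastInnerDrop, hsup]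
  have hspec := (Finset.mem_filter.1 hmem).2
  exact ⟨hspec.1, hspec.2, hle.trans (Finset.le_sup (f := id) hj)⟩

/-- Exchange the values of `σ*` at `n` and at its largest other drop. -/
def swapDrops {m : ℕ} (σ : Equiv.Perm (Fin (m + 1))) : Equiv.Perm (Fin (m + 1)) :=
  σ * Equiv.swap (lastInnerDrop σ) (Fin.last m)

lemma lastInnerDrop_swapDrops {m : ℕ} {σ : Equiv.Perm (Fin (m + 1))}
    (hv : cvalleyStarStat (m + 1) σ ≠ 0) (hdd : cddStarStat (m + 1) σ = 0) :
    lastInnerDrop (swapDrops σ) = lastInnerDrop σ := by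
  obtain ⟨-, hqq, hrq⟩ := lastInnerDrop_spec hv hdd
  have hset : innerDrops (swapDrops σ) = innerDrops σ := by
    refine Finset.filter_congr fun j _ => and_congr_right fun _ => ?_
    have h := (compare_starf_mul_swap hqq (Fin.le_last _) hrq (Fin.le_last _)
      (Finset.mem_Icc.2 ⟨by omega, j.2⟩ : (j : ℕ) + 1 ∈ Finset.Icc 1 (m + 1))).1
    rw [starf_val_add_one, starf_val_add_one] at h
    rw [Fin.le_def, Fin.le_def, swapDrops]
    omega
  rw [lastInnerDrop, hset, lastInnerDrop]

theorem statement17 (n k : ℕ) (hn : 1 ≤ n) (hk1 : 1 ≤ k)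
    (hk2 : k ≤ (n - 1) / 2) :
    (Polynomial.X + 1 : Polynomial ℤ) ∣ dPoly1 n k := by
  obtain ⟨m, rfl⟩ : ∃ m, n = m + 1 := ⟨n - 1, by omega⟩
  have hX : (Polynomial.X + 1 : Polynomial ℤ) = Polynomial.X - Polynomial.C (-1) := by simp
  rw [hX, Polynomial.dvd_iff_isRoot, Polynomial.IsRoot.def, dPoly1, Polynomial.eval_finsetSum]
  simp only [Polynomial.eval_pow, Polynomial.eval_X]
  have hstats : ∀ σ ∈ univ.filter (fun σ : Equiv.Perm (Fin (m + 1)) =>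
      cvalleyStarStat (m + 1) σ = k ∧ cddStarStat (m + 1) σ = 0),
      cvalleyStarStat (m + 1) σ ≠ 0 ∧ cddStarStat (m + 1) σ = 0 := by
    intro σ hσ
    have := (Finset.mem_filter.1 hσ).2
    exact ⟨by omega, this.2⟩
  refine Finset.sum_involution (fun σ _ => swapDrops σ) ?_ ?_ ?_ ?_
  · intro σ hσ
    obtain ⟨hlt, hqq, hrq⟩ := lastInnerDrop_spec (hstats σ hσ).1 (hstats σ hσ).2
    rw [swapDrops, neg_one_pow_mul_swap hqq (Fin.le_last _) hrq (Fin.le_last _) hlt.ne,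
      add_neg_cancel]
  · intro σ hσ _ heq
    obtain ⟨hlt, -, -⟩ := lastInnerDrop_spec (hstats σ hσ).1 (hstats σ hσ).2
    rw [swapDrops, mul_eq_left, Equiv.swap_eq_one_iff] at heq
    exact hlt.ne heq
  · intro σ hσ
    obtain ⟨-, hqq, hrq⟩ := lastInnerDrop_spec (hstats σ hσ).1 (hstats σ hσ).2
    rw [Finset.mem_filter, swapDrops,
      cvalleyStarStat_mul_swap hqq (Fin.le_last _) hrq (Fin.le_last _),
      cddStarStat_mul_swap hqq (Fin.le_last _) hrq (Fin.le_last _)]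
    exact ⟨Finset.mem_univ _, (Finset.mem_filter.1 hσ).2⟩
  · intro σ hσ
    have h := lastInnerDrop_swapDrops (hstats σ hσ).1 (hstats σ hσ).2
    rw [swapDrops, h, swapDrops, mul_assoc, Equiv.swap_mul_self, mul_one]

end SZpaper
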